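/- Let S¹ = ℝ/ℤ with its quotient metric and quotient map q : ℝ → S¹, and for n ≥ 2 let A_n = q([0, 1 - 1/n]). Then no subsequence of (A_n) converges in the second order Hausdorff distance to a continuum: for every continuum A ⊆ S¹ and every strictly increasing sequence (n_k), dist_{H²}(i(A_{n_k}), i(A)) does not converge to 0. In particular, the space of continua of S¹ with the metric dist_{H̃}(A,B) = dist_{H²}(i(A), i(B)) is not compact. -/

import Mathlib

open Metric Set Filter TopologicalSpace

instance : Fact ((0:ℝ) < 1) := ⟨zero_lt_one⟩

/-- The circle S¹ = ℝ/ℤ with its quotient metric. -/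
abbrev S1 : Type := AddCircle (1:ℝ)

/-- The hyperspace of continua (nonempty compact connected subsets) of `X`,
with the Hausdorff distance as its metric. -/
abbrev Continua (X : Type*) [MetricSpace X] :=
  {K : TopologicalSpace.NonemptyCompacts X // IsConnected (K : Set X)}

/-- i(A): the set of subcontinua of A, as a subset of the hyperspace. -/
def iSet {X : Type*} [MetricSpace X] (A : Continua X) : Set (Continua X) :=
  {B | (B.1 : Set X) ⊆ (A.1 : Set X)}

/-- The quotient map q : ℝ → S¹. -/
noncomputable def q (t : ℝ) : S1 := (t : S1)

lemma q_continuous : Continuous q := continuous_quotient_mk'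

lemma one_sub_inv_nonneg (n : ℕ) : (0:ℝ) ≤ 1 - 1/(n:ℝ) := by
  rcases Nat.eq_zero_or_pos n with h | h
  · simp [h]
  · have h1 : (1:ℝ) ≤ (n:ℝ) := by exact_mod_cast h
    have : 1/(n:ℝ) ≤ 1 := by rw [div_le_one (by linarith)]; exact h1
    linarith

/-- The arc A_n = q([0, 1 - 1/n]) of length 1 - 1/n starting at q(0),
as an element of the hyperspace. -/
noncomputable def arcC (n : ℕ) : Continua S1 :=
  ⟨⟨⟨q '' Icc 0 (1 - 1/(n:ℝ)), isCompact_Icc.image q_continuous⟩,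
    (nonempty_Icc.2 (one_sub_inv_nonneg n)).image q⟩,
    (isConnected_Icc (one_sub_inv_nonneg n)).image q q_continuous.continuousOn⟩

lemma exists_int_abs_sub_lt_of_dist_q_lt {a b r : ℝ} (h : dist (q a) (q b) < r) :
    ∃ m : ℤ, |a - b - m| < r := by
  refine ⟨round (a - b), ?_⟩
  have e : q a - q b = ((a - b : ℝ) : S1) := (AddCircle.coe_sub 1 a b).symm
  rw [dist_eq_norm, e, AddCircle.norm_eq] at h
  simpa using h

lemma exists_int_sub_eq_of_q_eq {a b : ℝ} (h : q a = q b) : ∃ m : ℤ, a - b = m := by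
  have e : ((a - b : ℝ) : S1) = 0 := by
    rw [AddCircle.coe_sub]; exact sub_eq_zero.2 h
  obtain ⟨m, hm⟩ := (AddCircle.coe_eq_zero_iff (1 : ℝ)).1 e
  exact ⟨m, by simpa using hm.symm⟩

lemma q_isOpenMap : IsOpenMap q := QuotientAddGroup.isOpenMap_coe

lemma exists_mem_Ico_q_eq (x : S1) : ∃ t ∈ Ico (0 : ℝ) 1, q t = x := by
  obtain ⟨s, rfl⟩ := QuotientAddGroup.mk_surjective x
  refine ⟨Int.fract s, ⟨Int.fract_nonneg s, Int.fract_lt_one s⟩, ?_⟩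
  have h : ((Int.fract s - s : ℝ) : S1) = 0 :=
    (AddCircle.coe_eq_zero_iff (1 : ℝ)).2 ⟨-⌊s⌋, by rw [← Int.self_sub_floor]; simp⟩
  rw [AddCircle.coe_sub] at h
  exact sub_eq_zero.1 h

section Hyperspace

variable {X : Type*} [MetricSpace X]

lemma mem_iSet_self (A : Continua X) : A ∈ iSet A := Subset.refl (A.1 : Set X)

lemma hausdorffEDist_iSet_ne_top [CompactSpace X] (A B : Continua X) :
    hausdorffEDist (iSet A) (iSet B) ≠ ⊤ := by
  have hb : ∀ S : Set (Continua X), Bornology.IsBounded S := fun S => by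
    obtain ⟨C, hC⟩ := isBounded_iff.1
      (isCompact_univ (X := NonemptyCompacts X)).isBounded
    exact isBounded_iff.2 ⟨C, fun x _ y _ => hC (mem_univ x.1) (mem_univ y.1)⟩
  exact hausdorffEDist_ne_top_of_nonempty_of_bounded ⟨A, mem_iSet_self A⟩ ⟨B, mem_iSet_self B⟩
    (hb _) (hb _)

lemma exists_dist_lt_of_dist_continua_lt {A B : Continua X} {x : X} {r : ℝ}
    (hx : x ∈ (A.1 : Set X)) (h : dist A B < r) : ∃ y ∈ (B.1 : Set X), dist x y < r := by
  rw [Subtype.dist_eq, NonemptyCompacts.dist_eq] at h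
  exact exists_dist_lt_of_hausdorffDist_lt hx h
    (hausdorffEDist_ne_top_of_nonempty_of_bounded A.1.nonempty B.1.nonempty
      A.1.isCompact.isBounded B.1.isCompact.isBounded)

end Hyperspace

/-- A limit of arcs of lengths tending to the full length is the whole circle. -/
lemma eq_univ_of_tendsto_hausdorffDist_iSet_arcC {A : Continua S1} {nk : ℕ → ℕ}
    (hnk : Tendsto nk atTop atTop)
    (h : Tendsto (fun k : ℕ => hausdorffDist (iSet (arcC (nk k))) (iSet A)) atTop (nhds 0)) :
    (A.1 : Set S1) = univ := by
  refine eq_univ_of_forall fun x => ?_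
  rw [← A.1.isCompact.isClosed.closure_eq, Metric.mem_closure_iff]
  intro ε hε
  obtain ⟨t, ⟨ht0, ht1⟩, rfl⟩ := exists_mem_Ico_q_eq x
  have hlim : Tendsto (fun k : ℕ => 1 / (nk k : ℝ)) atTop (nhds 0) :=
    tendsto_one_div_atTop_nhds_zero_nat.comp hnk
  obtain ⟨k, hk, hkt⟩ := ((h.eventually (gt_mem_nhds hε)).and
    (hlim.eventually (gt_mem_nhds (sub_pos.2 ht1)))).exists
  obtain ⟨B, hB, hAB⟩ := exists_dist_lt_of_hausdorffDist_lt (mem_iSet_self _) hk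
    (hausdorffEDist_iSet_ne_top _ _)
  have hx : q t ∈ ((arcC (nk k)).1 : Set S1) := ⟨t, ⟨ht0, by linarith⟩, rfl⟩
  obtain ⟨y, hy, hxy⟩ := exists_dist_lt_of_dist_continua_lt hx hAB
  exact ⟨y, hB hy, hxy⟩

/-- The arc of length `1 / 2` centred at `q 0`. -/
noncomputable def centredArc : Continua S1 :=
  ⟨⟨⟨q '' Icc (-(1 / 4)) (1 / 4), isCompact_Icc.image q_continuous⟩,
    (nonempty_Icc.2 (by norm_num)).image q⟩,
    (isConnected_Icc (by norm_num)).image q q_continuous.continuousOn⟩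

/-- A subcontinuum of an arc `q([0, 1 - 1/n])` cannot be close to an arc crossing `q 0`. -/
lemma le_dist_centredArc {n : ℕ} (hn : 0 < n) {C : Continua S1} (hC : C ∈ iSet (arcC n)) :
    1 / 8 ≤ dist centredArc C := by
  by_contra! hd
  have hn' : 0 < 1 / (n : ℝ) := by positivity
  have hlift : ∀ y ∈ (C.1 : Set S1), ∃ t ∈ Icc (0 : ℝ) (1 - 1 / n), q t = y := fun y hy => hC hy
  have hhalf : q (1 / 2) ∉ (C.1 : Set S1) := by
    intro hmem
    obtain ⟨_, ⟨b, ⟨hb1, hb2⟩, rfl⟩, hdist⟩ :=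
      exists_dist_lt_of_dist_continua_lt hmem (dist_comm centredArc C ▸ hd)
    obtain ⟨m, hm⟩ := exists_int_abs_sub_lt_of_dist_q_lt hdist
    rw [abs_lt] at hm
    have h0 : (0 : ℝ) < m := by linarith
    have h1 : (m : ℝ) < 1 := by linarith
    norm_cast at h0 h1
    omega
  have hnear : ∀ a ∈ Icc (-(1 / 4) : ℝ) (1 / 4), ∃ t ∈ Icc (0 : ℝ) (1 - 1 / n),
      q t ∈ (C.1 : Set S1) ∧ ∃ m : ℤ, |a - t - m| < 1 / 8 := by
    intro a ha
    obtain ⟨y, hy, hdist⟩ := exists_dist_lt_of_dist_continua_lt (A := centredArc) ⟨a, ha, rfl⟩ hd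
    obtain ⟨t, ht, rfl⟩ := hlift y hy
    exact ⟨t, ht, hy, exists_int_abs_sub_lt_of_dist_q_lt hdist⟩
  have hpre := C.2.isPreconnected (q '' Ioo (-(1 / n / 2)) (1 / 2))
    (q '' Ioo (1 / 2) (1 - 1 / n / 2)) (q_isOpenMap _ isOpen_Ioo) (q_isOpenMap _ isOpen_Ioo)
  obtain ⟨_, _, ⟨u, ⟨hu1, hu2⟩, rfl⟩, ⟨v, ⟨hv1, hv2⟩, huv⟩⟩ := hpre
    (by
      intro y hy
      obtain ⟨t, ⟨ht0, ht1⟩, rfl⟩ := hlift y hy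
      rcases lt_trichotomy t (1 / 2) with h | h | h
      · exact Or.inl ⟨t, ⟨by linarith, h⟩, rfl⟩
      · exact absurd (h ▸ hy) hhalf
      · exact Or.inr ⟨t, ⟨h, by linarith⟩, rfl⟩)
    (by
      obtain ⟨t, ⟨ht0, ht1⟩, hy, m, hm⟩ := hnear (1 / 4) ⟨by norm_num, le_rfl⟩
      rw [abs_lt] at hm
      have h0 : (-1 : ℝ) < m := by linarith
      have h1 : (m : ℝ) < 1 := by linarith
      norm_cast at h0 h1
      obtain rfl : m = 0 := by omega
      push_cast at hm
      exact ⟨_, hy, t, ⟨by linarith, by linarith⟩, rfl⟩)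
    (by
      obtain ⟨t, ⟨ht0, ht1⟩, hy, m, hm⟩ := hnear (-(1 / 4)) ⟨le_rfl, by norm_num⟩
      rw [abs_lt] at hm
      have h0 : (-2 : ℝ) < m := by linarith
      have h1 : (m : ℝ) < 0 := by linarith
      norm_cast at h0 h1
      obtain rfl : m = -1 := by omega
      push_cast at hm
      exact ⟨_, hy, t, ⟨by linarith, by linarith⟩, rfl⟩)
  obtain ⟨m, hm⟩ := exists_int_sub_eq_of_q_eq huv
  have h0 : (0 : ℝ) < m := by linarith
  have h1 : (m : ℝ) < 1 := by linarith
  norm_cast at h0 h1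
  omega

/-- No subsequence of (A_n)_{n ≥ 2} converges in the second order Hausdorff
distance to a continuum of S¹: for every continuum A and every strictly increasing
sequence (n_k) of indices, dist_{H²}(i(A_{n_k}), i(A)) does not converge to 0.
In particular, (C(S¹), dist_H̃) is not compact. -/
theorem no_subsequence_converges_in_second_order_hausdorff
    (A : Continua S1) (nk : ℕ → ℕ) (hmono : StrictMono nk) (hge : ∀ k, 2 ≤ nk k) :
    ¬ Tendsto (fun k : ℕ => hausdorffDist (iSet (arcC (nk k))) (iSet A))
        atTop (nhds 0) := by
  intro h
  have hA := eq_univ_of_tendsto_hausdorffDist_iSet_arcC hmono.tendsto_atTop h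
  obtain ⟨k, hk⟩ := (h.eventually (gt_mem_nhds (by norm_num : (0 : ℝ) < 1 / 8))).exists
  have hmem : centredArc ∈ iSet A := fun x _ => hA ▸ mem_univ x
  obtain ⟨C, hC, hdist⟩ := exists_dist_lt_of_hausdorffDist_lt' hmem hk
    (hausdorffEDist_iSet_ne_top _ _)
  rw [dist_comm] at hdist
  have hpos : 0 < nk k := by have := hge k; omega
  exact absurd hdist (not_lt.2 (le_dist_centredArc hpos hC))
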